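/- arXiv:2007.12327 — 2 statements merged into one kernel-verified Lean document; each statement's English description precedes it below -/
import Mathlib

section
/- The value iteration algorithm for the APT-DIFT game converges: for the sequence defined by V^(0) = 0 and V^(k+1) = T(V^(k)) and for every state s ∈ S, the sequence k ↦ V^(k)(s) converges as k → ∞, and its limit equals the supremum sup_k V^(k)(s). -/
open Classical in
/-- The Bellman operator of the APT-DIFT game: `T V s = β` on defender-winning
absorbing states, `0` on adversary-winning absorbing states, and otherwise the
supremum over defender probability vectors of the minimum over adversary
actions of the expected next-state value. -/
noncomputable def bellmanT {S A D : Type*} [Fintype S] [Fintype A] [Fintype D]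
    (β : ℝ) (WD WA : Set S) (P : S → A → D → S → ℝ) (V : S → ℝ) (s : S) : ℝ :=
  if s ∈ WD then β
  else if s ∈ WA then 0
  else sSup ((fun p : D → ℝ => ⨅ a : A, ∑ d : D, ∑ s' : S, p d * P s a d s' * V s') ''
    {p : D → ℝ | (∀ d, 0 ≤ p d) ∧ ∑ d : D, p d = 1})

/-- Monotonicity of the adversary's best-response value in the continuation values. -/
lemma iInf_expect_mono {S A D : Type*} [Fintype S] [Fintype A] [Fintype D]
    {P : A → D → S → ℝ} (hP : ∀ a d s', 0 ≤ P a d s')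
    {V W : S → ℝ} (hVW : V ≤ W) {p : D → ℝ} (hp : ∀ d, 0 ≤ p d) :
    ⨅ a, ∑ d, ∑ s', p d * P a d s' * V s' ≤ ⨅ a, ∑ d, ∑ s', p d * P a d s' * W s' := by
  refine ciInf_mono (Set.finite_range _).bddBelow fun a => ?_
  exact Finset.sum_le_sum fun d _ => Finset.sum_le_sum fun s' _ =>
    mul_le_mul_of_nonneg_left (hVW s') (mul_nonneg (hp d) (hP a d s'))

/-- A constant continuation value is preserved by the adversary's best response. -/
lemma iInf_expect_const {S A D : Type*} [Fintype S] [Fintype D] [Nonempty A]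
    {P : A → D → S → ℝ} (hPsum : ∀ a d, ∑ s', P a d s' = 1)
    {p : D → ℝ} (hp : ∑ d, p d = 1) (c : ℝ) :
    ⨅ a, ∑ d, ∑ s', p d * P a d s' * c = c := by
  simp [← Finset.sum_mul, ← Finset.mul_sum, hPsum, hp]

lemma exists_probability_vector (D : Type*) [Fintype D] [Nonempty D] :
    {p : D → ℝ | (∀ d, 0 ≤ p d) ∧ ∑ d, p d = 1}.Nonempty := by
  classical
  exact ⟨_, single_mem_stdSimplex ℝ (Classical.arbitrary D)⟩

section bellmanT

variable {S A D : Type*} [Fintype S] [Fintype A] [Fintype D]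
  {β : ℝ} {WD WA : Set S} {P : S → A → D → S → ℝ}

lemma bellmanT_nonneg (hβ : 0 ≤ β) (hPnonneg : ∀ s a d s', 0 ≤ P s a d s')
    {V : S → ℝ} (hV : ∀ s, 0 ≤ V s) (s : S) :
    0 ≤ bellmanT β WD WA P V s := by
  unfold bellmanT
  split_ifs
  · exact hβ
  · exact le_rfl
  · refine Real.sSup_nonneg ?_
    rintro _ ⟨p, ⟨hp, -⟩, rfl⟩
    exact Real.iInf_nonneg fun a => Finset.sum_nonneg fun d _ => Finset.sum_nonneg fun s' _ =>
      mul_nonneg (mul_nonneg (hp d) (hPnonneg s a d s')) (hV s')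

variable [Nonempty A] [Nonempty D]

lemma bellmanT_le_const (hβ : 0 ≤ β) (hPnonneg : ∀ s a d s', 0 ≤ P s a d s')
    (hPsum : ∀ s a d, ∑ s', P s a d s' = 1) {V : S → ℝ} (hV : ∀ s, V s ≤ β) (s : S) :
    bellmanT β WD WA P V s ≤ β := by
  unfold bellmanT
  split_ifs
  · exact le_rfl
  · exact hβ
  · refine csSup_le ((exists_probability_vector D).image _) ?_
    rintro _ ⟨p, ⟨hp, hp1⟩, rfl⟩
    exact (iInf_expect_mono (hPnonneg s) hV hp).trans_eq (iInf_expect_const (hPsum s) hp1 β)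

lemma bellmanT_mono (hPnonneg : ∀ s a d s', 0 ≤ P s a d s')
    (hPsum : ∀ s a d, ∑ s', P s a d s' = 1) :
    Monotone (bellmanT β WD WA P) := by
  intro V W hVW s
  unfold bellmanT
  split_ifs
  · exact le_rfl
  · exact le_rfl
  · obtain ⟨c, hc⟩ := (Set.finite_range W).bddAbove
    refine csSup_le ((exists_probability_vector D).image _) ?_
    rintro _ ⟨p, ⟨hp, hp1⟩, rfl⟩
    refine (iInf_expect_mono (hPnonneg s) hVW hp).trans (le_csSup ⟨c, ?_⟩ ⟨p, ⟨hp, hp1⟩, rfl⟩)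
    rintro _ ⟨q, ⟨hq, hq1⟩, rfl⟩
    exact (iInf_expect_mono (hPnonneg s) (fun s' => hc ⟨s', rfl⟩) hq).trans_eq
      (iInf_expect_const (hPsum s) hq1 c)

end bellmanT

open Filter in
/-- The value iteration algorithm converges: for the sequence `V 0 = 0`,
`V (k+1) = T (V k)`, and every state `s`, the sequence `k ↦ V k s` converges
as `k → ∞` to the supremum `⨆ k, V k s`. -/
theorem value_iteration_converges {S A D : Type*} [Fintype S] [Fintype A] [Fintype D]
    [Nonempty A] [Nonempty D]
    (β : ℝ) (hβ : 0 ≤ β) (WD WA : Set S) (hdisj : Disjoint WD WA)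
    (P : S → A → D → S → ℝ)
    (hPnonneg : ∀ s a d s', 0 ≤ P s a d s')
    (hPsum : ∀ s a d, ∑ s' : S, P s a d s' = 1)
    (V : ℕ → S → ℝ)
    (hV0 : V 0 = fun _ => 0)
    (hVsucc : ∀ k, V (k + 1) = bellmanT β WD WA P (V k)) :
    ∀ s : S, Tendsto (fun k => V k s) atTop (nhds (⨆ k, V k s)) := by
  have hle : ∀ k s, V k s ≤ β := by
    intro k
    induction k with
    | zero => simpa [hV0] using fun _ => hβ
    | succ k ih => rw [hVsucc]; exact bellmanT_le_const hβ hPnonneg hPsum ih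
  have hmono : Monotone V := by
    refine monotone_nat_of_le_succ fun k => ?_
    induction k with
    | zero =>
      rw [hVsucc, hV0]
      exact bellmanT_nonneg hβ hPnonneg fun _ => le_rfl
    | succ k ih =>
      rw [hVsucc (k + 1)]
      conv_lhs => rw [hVsucc k]
      exact bellmanT_mono hPnonneg hPsum ih
  intro s
  refine tendsto_atTop_ciSup (fun _ _ h => hmono h s) ⟨β, ?_⟩
  rintro _ ⟨k, rfl⟩
  exact hle k s
end

section
/- On an acyclic state space, the Bellman equation of the APT-DIFT game has a unique solution: suppose in addition to the standing hypotheses there is a relation r on S with no directed cycles (irreflexive transitive closure) such that for every non-absorbing state s ∉ W_A ∪ W_D and all a ∈ A, d ∈ D, s' ∈ S, P(s,a,d,s') > 0 implies r s s'. Then there exists exactly one function V : S → ℝ satisfying T(V) = V. -/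
/-- An operator whose value at `x` depends only on the values of its argument at the
predecessors of `x` for a well-founded relation has exactly one fixed point. -/
theorem WellFounded.existsUnique_fixedPoint {α β : Type*} [Nonempty β] {R : α → α → Prop}
    (hR : WellFounded R) (T : (α → β) → α → β)
    (hT : ∀ f g x, (∀ y, R y x → f y = g y) → T f x = T g x) :
    ∃! f : α → β, T f = f := by
  classical
  obtain ⟨b⟩ := ‹Nonempty β›
  let F : ∀ x, (∀ y, R y x → β) → β := fun x ih => T (fun y => if h : R y x then ih y h else b) x
  refine ⟨hR.fix F, ?_, fun g hg => ?_⟩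
  · funext x
    rw [hR.fix_eq F x]
    exact hT _ _ x fun y hy => by simp [hy]
  · funext x
    induction x using hR.induction with
    | _ x ih =>
      rw [hR.fix_eq F x, ← congrFun hg x]
      exact hT _ _ x fun y hy => by simp [hy, ih y hy]

/-- The Bellman operator at `s` depends only on the values at the states that can be reached
from `s` in one step, when `s` is not absorbing, and on no value at all otherwise. -/
theorem bellmanT_congr {S A D : Type*} [Fintype S] [Fintype A] [Fintype D]
    {β : ℝ} {WD WA : Set S} {P : S → A → D → S → ℝ} {V W : S → ℝ} {s : S}
    (h : s ∉ WA ∪ WD → ∀ a d s', P s a d s' ≠ 0 → V s' = W s') :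
    bellmanT β WD WA P V s = bellmanT β WD WA P W s := by
  unfold bellmanT
  split_ifs with hD hA
  · rfl
  · rfl
  · have hs : s ∉ WA ∪ WD := by simp [hD, hA]
    refine congrArg sSup (Set.image_congr fun p _ => iInf_congr fun a =>
      Finset.sum_congr rfl fun d _ => Finset.sum_congr rfl fun s' _ => ?_)
    by_cases hP : P s a d s' = 0
    · simp [hP]
    · rw [h hs a d s' hP]

/-- On an acyclic state space the Bellman equation of the APT-DIFT game has a
unique solution: if there is a relation `r` with no directed cycles such that
every positive-probability transition out of a non-absorbing state follows `r`,
then there is exactly one `V : S → ℝ` with `T V = V`. -/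
theorem bellman_unique_fixed_point {S A D : Type*} [Fintype S] [Fintype A] [Fintype D]
    [Nonempty A] [Nonempty D]
    (β : ℝ) (hβ : 0 ≤ β) (WD WA : Set S) (hdisj : Disjoint WD WA)
    (P : S → A → D → S → ℝ)
    (hPnonneg : ∀ s a d s', 0 ≤ P s a d s')
    (hPsum : ∀ s a d, ∑ s' : S, P s a d s' = 1)
    (r : S → S → Prop)
    (hacyc : ∀ s : S, ¬ Relation.TransGen r s s)
    (hr : ∀ s : S, s ∉ WA ∪ WD → ∀ (a : A) (d : D) (s' : S), 0 < P s a d s' → r s s') :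
    ∃! V : S → ℝ, bellmanT β WD WA P V = V := by
  have hwf : WellFounded fun y x => Relation.TransGen r x y := by
    have : IsTrans S fun y x => Relation.TransGen r x y := ⟨fun _ _ _ hab hbc => hbc.trans hab⟩
    have : Std.Irrefl fun y x => Relation.TransGen r x y := ⟨hacyc⟩
    exact Finite.wellFounded_of_trans_of_irrefl _
  refine hwf.existsUnique_fixedPoint _ fun V W s h => bellmanT_congr fun hs a d s' hP => ?_
  exact h s' (.single (hr s hs a d s' ((hPnonneg s a d s').lt_of_ne' hP)))
end
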